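/- Let q : ℝ × ℝ → ℝ be smooth and ζ ∈ ℂ \ {0}. Suppose Φ : ℝ × ℝ → Matrix (Fin 2) (Fin 2) ℂ is differentiable and satisfies ∂_x Φ(x,t) = X(x,t;ζ) · Φ(x,t) and ∂_t Φ(x,t) = T(x,t;ζ) · Φ(x,t) for all (x,t). Then Ψ(x,t) := conj(Φ(x,t)) (entrywise complex conjugation) satisfies ∂_x Ψ(x,t) = X(x,t; −conj ζ) · Ψ(x,t) and ∂_t Ψ(x,t) = T(x,t; −conj ζ) · Ψ(x,t) for all (x,t). -/

import Mathlib

/-- `k(z) = (z + δσ q₀²/z)/2`. -/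
noncomputable def kfun (δ σ q₀ : ℝ) (z : ℂ) : ℂ :=
  (z + (δ : ℂ) * (σ : ℂ) * (q₀ : ℂ) ^ 2 / z) / 2

/-- `λ(z) = (z − δσ q₀²/z)/2`. -/
noncomputable def lamfun (δ σ q₀ : ℝ) (z : ℂ) : ℂ :=
  (z - (δ : ℂ) * (σ : ℂ) * (q₀ : ℂ) ^ 2 / z) / 2

def pauli1 : Matrix (Fin 2) (Fin 2) ℂ := !![0, 1; 1, 0]

def pauli2 : Matrix (Fin 2) (Fin 2) ℂ := !![0, -Complex.I; Complex.I, 0]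

def pauli3 : Matrix (Fin 2) (Fin 2) ℂ := !![1, 0; 0, -1]

/-- Potential matrix `Q(x,t) = [[0, q(x,t)], [σ q(−x,−t), 0]]`. -/
noncomputable def Qmat (σ : ℝ) (q : ℝ → ℝ → ℝ) (x t : ℝ) : Matrix (Fin 2) (Fin 2) ℂ :=
  !![0, (q x t : ℂ); (σ : ℂ) * (q (-x) (-t) : ℂ), 0]

/-- `Q_x`, the entrywise partial `x`-derivative of `Q`. -/
noncomputable def Qxmat (σ : ℝ) (q : ℝ → ℝ → ℝ) (x t : ℝ) : Matrix (Fin 2) (Fin 2) ℂ :=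
  Matrix.of fun i j => deriv (fun y => Qmat σ q y t i j) x

/-- `Q_{xx}`, the entrywise second partial `x`-derivative of `Q`. -/
noncomputable def Qxxmat (σ : ℝ) (q : ℝ → ℝ → ℝ) (x t : ℝ) : Matrix (Fin 2) (Fin 2) ℂ :=
  Matrix.of fun i j => deriv (fun y => Qxmat σ q y t i j) x

/-- Lax matrix `X(x,t;z) = i k(z) σ₃ + Q(x,t)`. -/
noncomputable def Xlax (δ σ q₀ : ℝ) (q : ℝ → ℝ → ℝ) (x t : ℝ) (z : ℂ) :
    Matrix (Fin 2) (Fin 2) ℂ :=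
  (Complex.I * kfun δ σ q₀ z) • pauli3 + Qmat σ q x t

/-- Lax matrix
`T = (4k² + 2σ q(x,t) q(−x,−t)) X − 2 i k σ₃ Q_x + [Q_x, Q] − Q_{xx}`. -/
noncomputable def Tlax (δ σ q₀ : ℝ) (q : ℝ → ℝ → ℝ) (x t : ℝ) (z : ℂ) :
    Matrix (Fin 2) (Fin 2) ℂ :=
  (4 * kfun δ σ q₀ z ^ 2 + 2 * (σ : ℂ) * (q x t : ℂ) * (q (-x) (-t) : ℂ)) •
      Xlax δ σ q₀ q x t z
    - (2 * Complex.I * kfun δ σ q₀ z) • (pauli3 * Qxmat σ q x t)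
    + (Qxmat σ q x t * Qmat σ q x t - Qmat σ q x t * Qxmat σ q x t)
    - Qxxmat σ q x t

theorem aux_k (δ σ q₀ : ℝ) (z : ℂ) :
    kfun δ σ q₀ (-(starRingEnd ℂ z)) = -(starRingEnd ℂ (kfun δ σ q₀ z)) := by
  simp only [kfun, map_div₀, map_add, map_mul, map_pow, Complex.conj_ofReal, div_neg]
  rw [show (starRingEnd ℂ) 2 = 2 from Complex.conj_ofNat 2]
  ring

theorem aux_Q (σ : ℝ) (q : ℝ → ℝ → ℝ) (x t : ℝ) (i j : Fin 2) :
    starRingEnd ℂ (Qmat σ q x t i j) = Qmat σ q x t i j := by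
  fin_cases i <;> fin_cases j <;> simp [Qmat]

theorem aux_deriv (f : ℝ → ℂ) (hf : ∀ y, starRingEnd ℂ (f y) = f y) (x : ℝ) :
    starRingEnd ℂ (deriv f x) = deriv f x := by
  have h : deriv (fun y => star (f y)) x = star (deriv f x) := deriv.star
  have e : (fun y => star (f y)) = f := funext hf
  rw [e] at h
  exact h.symm

theorem aux_Qx (σ : ℝ) (q : ℝ → ℝ → ℝ) (x t : ℝ) (i j : Fin 2) :
    starRingEnd ℂ (Qxmat σ q x t i j) = Qxmat σ q x t i j :=
  aux_deriv _ (fun y => aux_Q σ q y t i j) x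

theorem aux_Qxx (σ : ℝ) (q : ℝ → ℝ → ℝ) (x t : ℝ) (i j : Fin 2) :
    starRingEnd ℂ (Qxxmat σ q x t i j) = Qxxmat σ q x t i j :=
  aux_deriv _ (fun y => aux_Qx σ q y t i j) x

theorem aux_X (δ σ q₀ : ℝ) (q : ℝ → ℝ → ℝ) (x t : ℝ) (z : ℂ) :
    Xlax δ σ q₀ q x t (-(starRingEnd ℂ z)) = (Xlax δ σ q₀ q x t z).map (starRingEnd ℂ) := by
  ext i j
  simp only [Xlax, aux_k, Matrix.map_apply, Matrix.add_apply, Matrix.smul_apply, map_add,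
    aux_Q, smul_eq_mul, map_mul, Complex.conj_I]
  fin_cases i <;> fin_cases j <;> simp [pauli3]

theorem aux_T (δ σ q₀ : ℝ) (q : ℝ → ℝ → ℝ) (x t : ℝ) (z : ℂ) :
    Tlax δ σ q₀ q x t (-(starRingEnd ℂ z)) = (Tlax δ σ q₀ q x t z).map (starRingEnd ℂ) := by
  have h2 : (starRingEnd ℂ) 2 = 2 := Complex.conj_ofNat 2
  have h4 : (starRingEnd ℂ) 4 = 4 := Complex.conj_ofNat 4
  ext i j
  simp only [Tlax, aux_k, aux_X, Matrix.map_apply, Matrix.add_apply, Matrix.sub_apply,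
    Matrix.smul_apply, map_add, map_sub, Matrix.mul_apply, Fin.sum_univ_two, map_pow,
    aux_Q, aux_Qx, aux_Qxx, smul_eq_mul, map_mul, Complex.conj_I, Complex.conj_ofReal, h2, h4]
  fin_cases i <;> fin_cases j <;> simp [pauli3]

theorem aux_D (f : ℝ → Matrix (Fin 2) (Fin 2) ℂ) (A B : Matrix (Fin 2) (Fin 2) ℂ) (x : ℝ)
    (i j : Fin 2) (h : HasDerivAt (fun y => f y i j) ((A * B) i j) x) :
    HasDerivAt (fun y => (f y).map (starRingEnd ℂ) i j)
      ((A.map (starRingEnd ℂ) * B.map (starRingEnd ℂ)) i j) x := by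
  rw [← Matrix.map_mul]
  exact h.star

/-- Second symmetry of solutions of the Lax pair: if `Φ` solves the Lax pair at
spectral parameter `ζ`, then `Ψ(x,t) = conj(Φ(x,t))` solves it at `−ζ̄`. -/
theorem second_symmetry_of_solutions
    (q₀ δ σ : ℝ) (hq₀ : 0 < q₀) (hδ : δ = 1 ∨ δ = -1) (hσ : σ = 1 ∨ σ = -1)
    (q : ℝ → ℝ → ℝ) (hq : ContDiff ℝ (⊤ : ℕ∞) fun p : ℝ × ℝ => q p.1 p.2)
    (ζ : ℂ) (hζ : ζ ≠ 0)
    (Φ : ℝ → ℝ → Matrix (Fin 2) (Fin 2) ℂ)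
    (hx : ∀ (x t : ℝ) (i j : Fin 2),
      HasDerivAt (fun y => Φ y t i j) ((Xlax δ σ q₀ q x t ζ * Φ x t) i j) x)
    (ht : ∀ (x t : ℝ) (i j : Fin 2),
      HasDerivAt (fun s => Φ x s i j) ((Tlax δ σ q₀ q x t ζ * Φ x t) i j) t) :
    ∀ (x t : ℝ) (i j : Fin 2),
      HasDerivAt (fun y => (Φ y t).map (starRingEnd ℂ) i j)
        ((Xlax δ σ q₀ q x t (-(starRingEnd ℂ ζ)) * (Φ x t).map (starRingEnd ℂ)) i j) x
      ∧ HasDerivAt (fun s => (Φ x s).map (starRingEnd ℂ) i j)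
        ((Tlax δ σ q₀ q x t (-(starRingEnd ℂ ζ)) * (Φ x t).map (starRingEnd ℂ)) i j) t := by
  intro x t i j
  rw [aux_X, aux_T]
  exact ⟨aux_D _ _ _ x i j (hx x t i j), aux_D _ _ _ t i j (ht x t i j)⟩
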